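/- Let G = (V,E) be a finite bipartite graph with unsigned incidence matrix B, n := |V| ≥ 3, m := |E| ≥ 3. Let ε satisfy 8·log(mn)/n ≤ ε ≤ 1/2 and set μ := ε/(4·log(mn)), and define f_μ(x) := Σ_{v∈V} x_v + μ·( Σ_{e∈E} exp((1 − [Bx]_e)/μ) + Σ_{v∈V} exp(−(x_v + ε/4)/μ) ). Then for any x ∈ ℝ^V with f_μ(x) < m, the entrywise truncation x' := min(x, 2·1) satisfies f_μ(x') ≤ f_μ(x). -/

import Mathlib

/-- A tangent-line bound for the decrease of `μ * exp (-t / μ)`. -/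
theorem mul_exp_sub_exp_le {μ A B d : ℝ} (hμ : 0 < μ) (hd : B = A - d) :
    μ * (Real.exp (A / μ) - Real.exp (B / μ)) ≤ Real.exp (A / μ) * d := by
  have h1 : Real.exp (B / μ) = Real.exp (A / μ) * Real.exp (-(d / μ)) := by
    rw [← Real.exp_add, hd]; congr 1; ring
  have h2 := Real.add_one_le_exp (-(d / μ))
  have h3 : μ * (d / μ) = d := by field_simp
  have h4 : μ * (1 - Real.exp (-(d / μ))) ≤ d := by nlinarith
  rw [h1]
  nlinarith [mul_le_mul_of_nonneg_left h4 (Real.exp_pos (A / μ)).le]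

theorem neg_le_add_mul_exp {μ : ℝ} (hμ : 0 < μ) (t c : ℝ) :
    -c ≤ t + μ * Real.exp (-(t + c) / μ) := by
  have h2 := Real.add_one_le_exp (-(t + c) / μ)
  have h3 : μ * (-(t + c) / μ) = -(t + c) := by field_simp
  nlinarith

/-- If `t` lies below `-3 μ log N`, the one-variable potential is large. -/
theorem le_add_mul_exp_of_lt {μ N t : ℝ} (hμ : 0 < μ) (hN : 1 ≤ N)
    (ht : t < -(3 * (μ * Real.log N))) :
    -(μ * Real.log N) + μ * (N ^ 2 - 2 * N)
      ≤ t + μ * Real.exp (-(t + μ * Real.log N) / μ) := by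
  have hN0 : 0 < N := by linarith
  set l := Real.log N with hl
  have hlN : l ≤ N := (Real.log_le_sub_one_of_pos hN0).trans (by linarith)
  obtain ⟨s, hs⟩ : ∃ s, s = -(t + μ * l) / μ := ⟨_, rfl⟩
  have hts : t = -(μ * l) - μ * s := by rw [hs]; field_simp; ring
  have hsl : 2 * l < s := by
    rw [hs, lt_div_iff₀ hμ]; nlinarith
  have hexp : Real.exp s = N ^ 2 * Real.exp (s - 2 * l) := by
    have : N ^ 2 = Real.exp (2 * l) := by
      rw [two_mul, Real.exp_add, hl, Real.exp_log hN0]; ring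
    rw [this, ← Real.exp_add]; congr 1; ring
  have h1 := Real.add_one_le_exp (s - 2 * l)
  have h2 : N ^ 2 - 2 * N ≤ Real.exp s - s := by
    rw [hexp]
    nlinarith [mul_le_mul_of_nonneg_left h1 (sq_nonneg N),
      mul_nonneg (by nlinarith : (0 : ℝ) ≤ N ^ 2 - 1) (sub_nonneg.2 hsl.le)]
  rw [← hs]
  nlinarith [mul_le_mul_of_nonneg_left h2 hμ.le]


/-- **Truncation does not increase the potential (fourth claim of Lemma `VC-relaxed`).**
`G = (V, E)` is a finite bipartite graph (endpoint maps `ends`, bipartition `L`),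
`n = |V| ≥ 3`, `m = |E| ≥ 3`.  With `8 log(mn)/n ≤ ε ≤ 1/2`, `μ = ε/(4 log(mn))` and
`f_μ(x) = Σ_v x_v + μ (Σ_e exp((1 - [Bx]_e)/μ) + Σ_v exp(-(x_v + ε/4)/μ))`,
any `x` with `f_μ(x) < m` satisfies `f_μ(min(x, 2·1)) ≤ f_μ(x)` where the minimum is
taken entrywise. -/
theorem stmt_14 {V E : Type*} [Fintype V] [Fintype E]
    (ends : E → V × V) (L : Set V)
    (hbip : ∀ e, (ends e).1 ∈ L ∧ (ends e).2 ∉ L)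
    (n m : ℕ) (hn : n = Fintype.card V) (hm : m = Fintype.card E)
    (hn3 : 3 ≤ n) (hm3 : 3 ≤ m)
    (ε μ : ℝ)
    (hεlow : 8 * Real.log ((m : ℝ) * n) / n ≤ ε) (hεhigh : ε ≤ 1/2)
    (hμ : μ = ε / (4 * Real.log ((m : ℝ) * n)))
    (fμ : (V → ℝ) → ℝ)
    (hfμ : ∀ x, fμ x = (∑ v, x v)
        + μ * ((∑ e, Real.exp ((1 - (x (ends e).1 + x (ends e).2)) / μ))
            + ∑ v, Real.exp (-(x v + ε/4) / μ))) :
    ∀ x : V → ℝ, fμ x < (m : ℝ) → fμ (fun v => min (x v) 2) ≤ fμ x := by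
  classical
  intro x hx
  have hn3' : (3 : ℝ) ≤ n := by exact_mod_cast hn3
  have hm3' : (3 : ℝ) ≤ m := by exact_mod_cast hm3
  obtain ⟨N, hN⟩ : ∃ N : ℝ, N = (m : ℝ) * n := ⟨_, rfl⟩
  have hN9 : 9 ≤ N := by rw [hN]; nlinarith
  rw [← hN] at hεlow hμ
  obtain ⟨l, hl⟩ : ∃ l : ℝ, l = Real.log N := ⟨_, rfl⟩
  have hl0 : 0 < l := hl ▸ Real.log_pos (by linarith)
  rw [← hl] at hεlow hμ
  have hn0 : (0 : ℝ) < n := by linarith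
  rw [div_le_iff₀ hn0] at hεlow
  have hε0 : 0 < ε := by
    by_contra h
    nlinarith
  have hμ0 : 0 < μ := by rw [hμ]; positivity
  have hμl : ε / 4 = μ * l := by rw [hμ]; field_simp
  have hμn : 2 ≤ μ * n := by
    rw [hμ, div_mul_eq_mul_div, le_div_iff₀ (by positivity)]; linarith
  have hsum : ∀ y : V → ℝ, fμ y = (∑ v, (y v + μ * Real.exp (-(y v + ε / 4) / μ)))
      + ∑ e, μ * Real.exp ((1 - (y (ends e).1 + y (ends e).2)) / μ) := by
    intro y
    rw [hfμ, Finset.sum_add_distrib, ← Finset.mul_sum, ← Finset.mul_sum]; ring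
  have hlow : ∀ v, -(3 / 8) ≤ x v := by
    intro v
    by_contra! hv
    have h1 := le_add_mul_exp_of_lt (t := x v) hμ0 (by linarith : 1 ≤ N)
      (by rw [← hl, ← hμl]; linarith)
    rw [← hl, ← hμl] at h1
    have h2 : (∑ w, (-(ε / 4) + if w = v then μ * (N ^ 2 - 2 * N) else 0))
        ≤ ∑ w, (x w + μ * Real.exp (-(x w + ε / 4) / μ)) := by
      refine Finset.sum_le_sum fun w _ => ?_
      split_ifs with h
      · rw [h]; exact h1
      · simpa using neg_le_add_mul_exp hμ0 (x w) (ε / 4)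
    have h3 : 0 ≤ ∑ e, μ * Real.exp ((1 - (x (ends e).1 + x (ends e).2)) / μ) :=
      Finset.sum_nonneg fun e _ => by positivity
    rw [Finset.sum_add_distrib, Finset.sum_ite_eq' Finset.univ v] at h2
    simp only [Finset.sum_const, Finset.card_univ, ← hn, nsmul_eq_mul, Finset.mem_univ,
      if_true] at h2
    rw [hsum] at hx
    have h4 : 2 * m * (N - 2) ≤ μ * (N ^ 2 - 2 * N) := by
      have : μ * (N ^ 2 - 2 * N) = (μ * n) * (m * (N - 2)) := by
        rw [pow_two, ← sub_mul]; nth_rewrite 2 [hN]; ring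
      rw [this]
      nlinarith [mul_le_mul_of_nonneg_right hμn
        (mul_nonneg (by linarith : (0 : ℝ) ≤ m) (by linarith : (0 : ℝ) ≤ N - 2))]
    have h5 : n * ε ≤ n * (1 / 2) := mul_le_mul_of_nonneg_left hεhigh hn0.le
    have h6 : (m : ℝ) + n / 8 ≤ 2 * m * (N - 2) := by
      have : (n : ℝ) ≤ N := by rw [hN]; nlinarith
      nlinarith
    linarith
  obtain ⟨K, hK⟩ : ∃ K : ℝ, K = Real.exp (-(5 / 8) / μ) := ⟨_, rfl⟩
  have hK0 : 0 ≤ K := hK ▸ (Real.exp_pos _).le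
  have hKN : K * N ^ 2 ≤ 1 := by
    have h1 : N ^ 2 = Real.exp (2 * l) := by
      rw [two_mul, Real.exp_add, hl, Real.exp_log (by linarith)]; ring
    rw [h1, hK, ← Real.exp_add]
    refine Real.exp_le_one_iff.2 ?_
    have : 2 * l ≤ 5 / 8 / μ := by
      rw [le_div_iff₀ hμ0]; linarith
    rw [neg_div]; linarith
  have hKm : K * (2 * m + 1) ≤ 1 := by
    refine le_trans (mul_le_mul_of_nonneg_left ?_ hK0) hKN
    have : 3 * (m : ℝ) ≤ N := by rw [hN]; nlinarith
    nlinarith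
  have hKexp : ∀ t : ℝ, t ≤ -(5 / 8) → Real.exp (t / μ) ≤ K := fun t ht => by
    rw [hK]; gcongr
  obtain ⟨δ, hδ⟩ : ∃ δ : V → ℝ, ∀ v, δ v = x v - min (x v) 2 := ⟨_, fun _ => rfl⟩
  have hδ0 : ∀ v, 0 ≤ δ v := fun v => by rw [hδ]; linarith [min_le_left (x v) 2]
  have hcase : ∀ v, (δ v = 0 ∧ min (x v) 2 = x v) ∨ min (x v) 2 = 2 := by
    intro v
    rcases le_total (x v) 2 with h | h
    · left; rw [hδ, min_eq_left h]; simp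
    · right; exact min_eq_right h
  have hlow' : ∀ v, -(3 / 8) ≤ min (x v) 2 := fun v => le_min (hlow v) (by norm_num)
  have hvert : ∀ v, min (x v) 2 + μ * Real.exp (-(min (x v) 2 + ε / 4) / μ)
      ≤ (x v + μ * Real.exp (-(x v + ε / 4) / μ)) + (K - 1) * δ v := by
    intro v
    have h1 := mul_exp_sub_exp_le (A := -(min (x v) 2 + ε / 4)) (B := -(x v + ε / 4))
      (d := δ v) hμ0 (by rw [hδ]; ring)
    have h2 : Real.exp (-(min (x v) 2 + ε / 4) / μ) * δ v ≤ K * δ v := by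
      rcases hcase v with h | h
      · simp [h.1]
      · exact mul_le_mul_of_nonneg_right (hKexp _ (by rw [h]; linarith)) (hδ0 v)
    linarith [hδ v]
  have hedge : ∀ e, μ * Real.exp ((1 - (min (x (ends e).1) 2 + min (x (ends e).2) 2)) / μ)
      ≤ μ * Real.exp ((1 - (x (ends e).1 + x (ends e).2)) / μ) + K * (2 * ∑ v, δ v) := by
    intro e
    have hs : ∀ v, δ v ≤ ∑ v, δ v := fun v =>
      Finset.single_le_sum (fun w _ => hδ0 w) (Finset.mem_univ v)
    have h1 := mul_exp_sub_exp_le (A := 1 - (min (x (ends e).1) 2 + min (x (ends e).2) 2))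
      (B := 1 - (x (ends e).1 + x (ends e).2)) (d := δ (ends e).1 + δ (ends e).2) hμ0
      (by rw [hδ, hδ]; ring)
    have h2 : Real.exp ((1 - (min (x (ends e).1) 2 + min (x (ends e).2) 2)) / μ)
        * (δ (ends e).1 + δ (ends e).2) ≤ K * (δ (ends e).1 + δ (ends e).2) := by
      have h0 := add_nonneg (hδ0 (ends e).1) (hδ0 (ends e).2)
      rcases hcase (ends e).1 with h | h
      · rcases hcase (ends e).2 with h' | h'
        · simp [h.1, h'.1]
        · exact mul_le_mul_of_nonneg_right
            (hKexp _ (by linarith [hlow' (ends e).1])) h0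
      · exact mul_le_mul_of_nonneg_right
          (hKexp _ (by linarith [hlow' (ends e).2])) h0
    have h3 := mul_le_mul_of_nonneg_left (add_le_add (hs (ends e).1) (hs (ends e).2)) hK0
    linarith
  have hV := Finset.sum_le_sum fun v (_ : v ∈ Finset.univ) => hvert v
  have hE := Finset.sum_le_sum fun e (_ : e ∈ Finset.univ) => hedge e
  rw [Finset.sum_add_distrib (g := fun v => (K - 1) * δ v), ← Finset.mul_sum] at hV
  rw [Finset.sum_add_distrib (f := fun e => μ * Real.exp _), Finset.sum_const,
    Finset.card_univ, ← hm, nsmul_eq_mul] at hE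
  rw [hsum, hsum]
  have hD : 0 ≤ ∑ v, δ v := Finset.sum_nonneg fun v _ => hδ0 v
  nlinarith [mul_le_mul_of_nonneg_right hKm hD]
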